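/- Let F be a CNF with r clauses C₁,…,C_r in n variables x₁,…,x_n, and let γ_F be the assignment with domain all C-variables of SAT^{n,r} given by γ_F(C(m,ℓ,b)) = 1 if x_ℓ^b ∈ C_m and γ_F(C(m,ℓ,b)) = 0 otherwise. Then there is a substitution τ mapping the variables of SAT^{n,r}↾γ_F to {0, 1} ∪ {x_ℓ, ¬x_ℓ : ℓ ∈ [n]} such that (SAT^{n,r}↾γ_F)↾τ is exactly F together with some tautological clauses in the variables x₁,…,x_n. -/

import Mathlib

open Classical Finset

structure Lit (V : Type) where
  var : V
  pos : Bool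
deriving DecidableEq

abbrev Clause (V : Type) := Finset (Lit V)
abbrev PTerm (V : Type) := Finset (Lit V)
abbrev Cnf (V : Type) := Finset (Clause V)
abbrev Dnf (V : Type) := Finset (PTerm V)

variable {V : Type} [DecidableEq V]

def Lit.neg (l : Lit V) : Lit V := ⟨l.var, !l.pos⟩

/-- A clause viewed as a 1-DNF. -/
def clauseToDnf (C : Clause V) : Dnf V := C.image (fun l => {l})

/-- A `k`-DNF: every term has at most `k` literals. -/
def IsKDnf (k : ℕ) (G : Dnf V) : Prop := ∀ q ∈ G, q.card ≤ k

/-- The inference rules of Res(k): axiom, weakening, ∧-introduction and cut. -/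
inductive ResKInf (k : ℕ) : List (Dnf V) → Dnf V → Prop
  | ax (x : V) :
      ResKInf k [] {{(⟨x, true⟩ : Lit V)}, {(⟨x, false⟩ : Lit V)}}
  | weaken (A B : Dnf V) : ResKInf k [A] (A ∪ B)
  | andIntro (A B : Dnf V) (l : Lit V) (q : PTerm V) (hq : q.card + 1 ≤ k) :
      ResKInf k [A ∪ {({l} : PTerm V)}, B ∪ {q}] (A ∪ B ∪ {insert l q})
  | cut (A B : Dnf V) (q : PTerm V) :
      ResKInf k [A ∪ {q}, B ∪ q.image (fun l => ({l.neg} : PTerm V))] (A ∪ B)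

/-- A Res(k) refutation of the CNF `F`: a sequence of k-DNFs, each a clause of `F`
or inferred from earlier lines, ending with the empty clause. -/
def IsResKRefutation (k : ℕ) (F : Set (Clause V)) (P : List (Dnf V)) : Prop :=
  P ≠ [] ∧ P.getLast? = some (∅ : Dnf V) ∧ (∀ G ∈ P, IsKDnf k G) ∧
  ∀ i : Fin P.length,
    (∃ C ∈ F, P.get i = clauseToDnf C) ∨
    ∃ prems : List (Dnf V), ResKInf k prems (P.get i) ∧
      ∀ Q ∈ prems, ∃ j : Fin P.length, (j : ℕ) < (i : ℕ) ∧ P.get j = Q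

/-- The number of symbols in a DNF. -/
def dnfSize (G : Dnf V) : ℕ := ∑ q ∈ G, (q.card + 1)

/-- The size (number of symbols) of a Res(k) refutation. -/
def proofSize (P : List (Dnf V)) : ℕ := (P.map dnfSize).sum

/-- The size (number of symbols) of a CNF. -/
def cnfSize (F : Cnf V) : ℕ := ∑ C ∈ F, (C.card + 1)

/-- The set of propositional variables occurring in a CNF. -/
def cnfVars (F : Cnf V) : Finset V := F.sup (fun C => C.image Lit.var)

def SatClauseA (a : V → Bool) (C : Clause V) : Prop := ∃ l ∈ C, a l.var = l.pos

/-- Unsatisfiability of a CNF. -/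
def Unsat (F : Set (Clause V)) : Prop := ¬ ∃ a : V → Bool, ∀ C ∈ F, SatClauseA a C

def litSatP (π : V → Option Bool) (l : Lit V) : Prop := π l.var = some l.pos
def litFalsP (π : V → Option Bool) (l : Lit V) : Prop := π l.var = some (!l.pos)

/-- A partial assignment satisfies a term if it satisfies all its literals. -/
def satPTerm (π : V → Option Bool) (q : PTerm V) : Prop := ∀ l ∈ q, litSatP π l
/-- A partial assignment falsifies a term if it falsifies some literal of it. -/
def falsPTerm (π : V → Option Bool) (q : PTerm V) : Prop := ∃ l ∈ q, litFalsP π l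

/-- The restriction of a DNF by a partial assignment: falsified terms are removed,
and satisfied literals are removed from the remaining terms. -/
noncomputable def restrictDnf (G : Dnf V) (π : V → Option Bool) : Dnf V :=
  (G.filter (fun q => ¬ falsPTerm π q)).image (fun q => q.filter (fun l => ¬ litSatP π l))

def clauseSatP (π : V → Option Bool) (C : Clause V) : Prop := ∃ l ∈ C, litSatP π l

/-- The restriction of a clause: falsified literals are removed. -/
noncomputable def restrictClause (C : Clause V) (π : V → Option Bool) : Clause V :=
  C.filter (fun l => ¬ litFalsP π l)

/-- The restriction of a CNF by a partial assignment: satisfied clauses are removed,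
falsified literals are removed from the remaining clauses. -/
def restrictCnfSet (F : Set (Clause V)) (π : V → Option Bool) : Set (Clause V) :=
  {E | ∃ C ∈ F, ¬ clauseSatP π C ∧ E = restrictClause C π}

/-- A resolution refutation of the CNF `F` (weakening is built into the rules). -/
def IsResRefutation (F : Set (Clause V)) (P : List (Clause V)) : Prop :=
  P ≠ [] ∧ P.getLast? = some (∅ : Clause V) ∧
  ∀ i : Fin P.length,
    (∃ C ∈ F, C ⊆ P.get i) ∨
    ∃ jv jw : Fin P.length, (jv : ℕ) < (i : ℕ) ∧ (jw : ℕ) < (i : ℕ) ∧ ∃ x : V,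
      (⟨x, true⟩ : Lit V) ∈ P.get jv ∧ (⟨x, false⟩ : Lit V) ∈ P.get jw ∧
      ((P.get jv).erase ⟨x, true⟩ ∪ (P.get jw).erase ⟨x, false⟩) ⊆ P.get i

/-- The variables of `SAT^{n,r}`. -/
inductive SVar : Type
  | C (m ℓ : ℕ) (b : Bool)
  | T (ℓ : ℕ)
  | Tc (m ℓ : ℕ) (b : Bool)
deriving DecidableEq

/-- The CNF `SAT^{n,r}`. -/
def satCnf (n r : ℕ) : Cnf SVar :=
  ((Finset.Icc 1 r).image (fun m =>
      (Finset.Icc 1 n ×ˢ ({true, false} : Finset Bool)).image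
        (fun p => (⟨.Tc m p.1 p.2, true⟩ : Lit SVar)))) ∪
  ((Finset.Icc 1 r ×ˢ Finset.Icc 1 n).image (fun p =>
      ({⟨.Tc p.1 p.2 true, false⟩, ⟨.T p.2, true⟩} : Clause SVar))) ∪
  ((Finset.Icc 1 r ×ˢ Finset.Icc 1 n).image (fun p =>
      ({⟨.Tc p.1 p.2 false, false⟩, ⟨.T p.2, false⟩} : Clause SVar))) ∪
  ((Finset.Icc 1 r ×ˢ Finset.Icc 1 n ×ˢ ({true, false} : Finset Bool)).image (fun p =>
      ({⟨.Tc p.1 p.2.1 p.2.2, false⟩, ⟨.C p.1 p.2.1 p.2.2, true⟩} : Clause SVar)))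

/-- The assignment `γ_F` to the `C`-variables describing the CNF `F` with the `r` clauses
`Cm 1, …, Cm r` in `n` variables. -/
def gammaF (n r : ℕ) (Cm : ℕ → Clause ℕ) : SVar → Option Bool
  | .C m ℓ b =>
      if m ∈ Finset.Icc 1 r ∧ ℓ ∈ Finset.Icc 1 n then some (decide ((⟨ℓ, b⟩ : Lit ℕ) ∈ Cm m))
      else none
  | _ => none

/-- The restriction of a CNF (as a finite set of clauses) by a partial assignment. -/
noncomputable def restrictCnf {V : Type} [DecidableEq V] (F : Cnf V) (π : V → Option Bool) :
    Cnf V :=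
  (F.filter (fun C => ¬ clauseSatP π C)).image (fun C => restrictClause C π)

/-- A value of a substitution: a constant `0`/`1` or a literal. -/
inductive SubstVal : Type
  | bit (b : Bool)
  | lit (l : Lit ℕ)
deriving DecidableEq

/-- The literal `l` is satisfied by the substitution (its variable is mapped to the
matching constant). -/
def litSatBySubst (τ : SVar → SubstVal) (l : Lit SVar) : Prop :=
  τ l.var = .bit l.pos

/-- The literal `l` is falsified by the substitution. -/
def litFalsBySubst (τ : SVar → SubstVal) (l : Lit SVar) : Prop :=
  τ l.var = .bit (!l.pos)

/-- The result of substituting into the literal `l` a literal of the `x`-variables. -/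
def substLit (τ : SVar → SubstVal) (l : Lit SVar) : Lit ℕ :=
  match τ l.var with
  | .bit _ => ⟨0, true⟩
  | .lit m => ⟨m.var, l.pos == m.pos⟩

/-- Application of a substitution to a CNF: clauses containing a satisfied literal are
removed, falsified literals are removed, and the remaining literals are substituted. -/
noncomputable def substCnf (τ : SVar → SubstVal) (F : Cnf SVar) : Cnf ℕ :=
  (F.filter (fun C => ¬ ∃ l ∈ C, litSatBySubst τ l)).image
    (fun C => (C.filter (fun l => ∀ b : Bool, τ l.var ≠ .bit b)).image (substLit τ))

/-- A clause is tautological if it contains both literals of some variable. -/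
def Tautological (C : Clause ℕ) : Prop :=
  ∃ x : ℕ, (⟨x, true⟩ : Lit ℕ) ∈ C ∧ (⟨x, false⟩ : Lit ℕ) ∈ C

/-- The substitution sending `T(ℓ)` to `x_ℓ`, and `T(m,ℓ,b)` to `x_ℓ^b` if this literal occurs
in the `m`-th clause and to `0` otherwise. -/
def witnessSubst (n r : ℕ) (Cm : ℕ → Clause ℕ) : SVar → SubstVal
  | .C _ _ _ => .bit false
  | .T ℓ => if ℓ ∈ Finset.Icc 1 n then .lit ⟨ℓ, true⟩ else .bit false
  | .Tc m ℓ b =>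
      if m ∈ Finset.Icc 1 r ∧ ℓ ∈ Finset.Icc 1 n ∧ (⟨ℓ, b⟩ : Lit ℕ) ∈ Cm m then .lit ⟨ℓ, b⟩
      else .bit false

theorem witnessSubst_lit_var_mem {n r : ℕ} {Cm : ℕ → Clause ℕ} {v : SVar} {l : Lit ℕ}
    (h : witnessSubst n r Cm v = .lit l) : l.var ∈ Finset.Icc 1 n := by
  cases v with
  | C m ℓ b => simp [witnessSubst] at h
  | T ℓ =>
    simp only [witnessSubst] at h
    split_ifs at h with h1
    cases h
    exact h1
  | Tc m ℓ b =>
    simp only [witnessSubst] at h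
    split_ifs at h with h1
    cases h
    exact h1.2.1

theorem witnessSubst_ne_bit_true (n r : ℕ) (Cm : ℕ → Clause ℕ) (v : SVar) :
    witnessSubst n r Cm v ≠ .bit true := by
  cases v <;> simp only [witnessSubst] <;> (try split_ifs) <;> simp

/-- The clause obtained by applying a substitution to a clause it does not satisfy. -/
noncomputable def substClause (τ : SVar → SubstVal) (C : Clause SVar) : Clause ℕ :=
  (C.filter (fun l => ∀ b : Bool, τ l.var ≠ .bit b)).image (substLit τ)

theorem mem_substCnf_restrictCnf {τ : SVar → SubstVal} {F : Cnf SVar} {π : SVar → Option Bool}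
    {E : Clause ℕ} :
    E ∈ substCnf τ (restrictCnf F π) ↔ ∃ C ∈ F, ¬ clauseSatP π C ∧
      (∀ l ∈ restrictClause C π, ¬ litSatBySubst τ l) ∧
      substClause τ (restrictClause C π) = E := by
  simp only [substCnf, restrictCnf, substClause, Finset.mem_image, Finset.mem_filter]
  constructor
  · rintro ⟨_, ⟨⟨C, ⟨hC, hs⟩, rfl⟩, hτ⟩, hE⟩
    exact ⟨C, hC, hs, fun l hl h => hτ ⟨l, hl, h⟩, hE⟩
  · rintro ⟨C, hC, hs, hτ, hE⟩
    exact ⟨_, ⟨⟨C, ⟨hC, hs⟩, rfl⟩, fun ⟨l, hl, h⟩ => hτ l hl h⟩, hE⟩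

theorem restrictClause_eq_self {V : Type} [DecidableEq V] {C : Clause V} {π : V → Option Bool}
    (h : ∀ l ∈ C, π l.var = none) : restrictClause C π = C :=
  Finset.filter_true_of_mem fun l hl => by simp [litFalsP, h l hl]

theorem not_clauseSatP_of_forall_eq_none {V : Type} {C : Clause V} {π : V → Option Bool}
    (h : ∀ l ∈ C, π l.var = none) : ¬ clauseSatP π C := by
  rintro ⟨l, hl, hs⟩
  simp [litSatP, h l hl] at hs

theorem var_mem_of_mem_substClause {n r : ℕ} {Cm : ℕ → Clause ℕ} {C : Clause SVar} {l : Lit ℕ}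
    (hl : l ∈ substClause (witnessSubst n r Cm) C) : l.var ∈ Finset.Icc 1 n := by
  simp only [substClause, Finset.mem_image, Finset.mem_filter] at hl
  obtain ⟨k, ⟨-, hk⟩, rfl⟩ := hl
  cases h : witnessSubst n r Cm k.var with
  | bit b => exact absurd h (hk b)
  | lit m => simpa [substLit, h] using witnessSubst_lit_var_mem h

/-- The clause of `SAT^{n,r}` saying that some literal of the `m`-th clause is true. -/
def truthClause (n m : ℕ) : Clause SVar :=
  (Finset.Icc 1 n ×ˢ ({true, false} : Finset Bool)).image
    (fun p => (⟨.Tc m p.1 p.2, true⟩ : Lit SVar))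

theorem mem_truthClause {n m : ℕ} {l : Lit SVar} :
    l ∈ truthClause n m ↔ ∃ ℓ ∈ Finset.Icc 1 n, ∃ b : Bool, l = ⟨.Tc m ℓ b, true⟩ := by
  simp only [truthClause, Finset.mem_image, Finset.mem_product, Prod.exists]
  constructor
  · rintro ⟨ℓ, b, ⟨hℓ, -⟩, rfl⟩
    exact ⟨ℓ, hℓ, b, rfl⟩
  · rintro ⟨ℓ, hℓ, b, rfl⟩
    exact ⟨ℓ, b, ⟨hℓ, by cases b <;> simp⟩, rfl⟩

theorem gammaF_eq_none_of_mem_truthClause {n r m : ℕ} {Cm : ℕ → Clause ℕ} :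
    ∀ l ∈ truthClause n m, gammaF n r Cm l.var = none := by
  intro l hl
  obtain ⟨ℓ, -, b, rfl⟩ := mem_truthClause.1 hl
  rfl

theorem substClause_truthClause {n r m : ℕ} {Cm : ℕ → Clause ℕ} (hm : m ∈ Finset.Icc 1 r)
    (hC : ∀ l ∈ Cm m, l.var ∈ Finset.Icc 1 n) :
    substClause (witnessSubst n r Cm) (truthClause n m) = Cm m := by
  ext l
  simp only [substClause, Finset.mem_image, Finset.mem_filter]
  constructor
  · rintro ⟨k, ⟨hk, hb⟩, rfl⟩
    obtain ⟨ℓ, hℓ, b, rfl⟩ := mem_truthClause.1 hk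
    by_cases h : (⟨ℓ, b⟩ : Lit ℕ) ∈ Cm m
    · have hv : witnessSubst n r Cm (.Tc m ℓ b) = .lit ⟨ℓ, b⟩ := if_pos ⟨hm, hℓ, h⟩
      simpa [substLit, hv] using h
    · exact absurd (if_neg fun h' => h h'.2.2) (hb false)
  · intro hl
    have hv : witnessSubst n r Cm (.Tc m l.var l.pos) = .lit l :=
      if_pos ⟨hm, hC l hl, hl⟩
    refine ⟨⟨.Tc m l.var l.pos, true⟩, ⟨mem_truthClause.2 ⟨_, hC l hl, _, rfl⟩, ?_⟩, ?_⟩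
    · simp [hv]
    · simp [substLit, hv]

theorem mem_satCnf {n r : ℕ} {C : Clause SVar} :
    C ∈ satCnf n r ↔
      (∃ m ∈ Finset.Icc 1 r, C = truthClause n m) ∨
      ∃ m ∈ Finset.Icc 1 r, ∃ ℓ ∈ Finset.Icc 1 n, ∃ b : Bool,
        C = {⟨.Tc m ℓ b, false⟩, ⟨.T ℓ, b⟩} ∨
        C = {⟨.Tc m ℓ b, false⟩, ⟨.C m ℓ b, true⟩} := by
  simp only [satCnf, Finset.mem_union, Finset.mem_image, Finset.mem_product,
    Prod.exists]
  constructor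
  · rintro (((⟨m, hm, rfl⟩ | ⟨m, ℓ, ⟨hm, hℓ⟩, rfl⟩) | ⟨m, ℓ, ⟨hm, hℓ⟩, rfl⟩) |
      ⟨m, ℓ, b, ⟨hm, hℓ, -⟩, rfl⟩)
    · exact .inl ⟨m, hm, rfl⟩
    · exact .inr ⟨m, hm, ℓ, hℓ, true, .inl rfl⟩
    · exact .inr ⟨m, hm, ℓ, hℓ, false, .inl rfl⟩
    · exact .inr ⟨m, hm, ℓ, hℓ, b, .inr rfl⟩
  · rintro (⟨m, hm, rfl⟩ | ⟨m, hm, ℓ, hℓ, b, rfl | rfl⟩)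
    · exact .inl (.inl (.inl ⟨m, hm, rfl⟩))
    · cases b
      · exact .inl (.inr ⟨m, ℓ, ⟨hm, hℓ⟩, rfl⟩)
      · exact .inl (.inl (.inr ⟨m, ℓ, ⟨hm, hℓ⟩, rfl⟩))
    · exact .inr ⟨m, ℓ, b, ⟨hm, hℓ, by cases b <;> simp⟩, rfl⟩

theorem tautological_substClause {n r m ℓ : ℕ} {b : Bool} {Cm : ℕ → Clause ℕ}
    (hm : m ∈ Finset.Icc 1 r) (hℓ : ℓ ∈ Finset.Icc 1 n) (h : (⟨ℓ, b⟩ : Lit ℕ) ∈ Cm m) :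
    Tautological (substClause (witnessSubst n r Cm) {⟨.Tc m ℓ b, false⟩, ⟨.T ℓ, b⟩}) := by
  have h1 : witnessSubst n r Cm (.Tc m ℓ b) = .lit ⟨ℓ, b⟩ := if_pos ⟨hm, hℓ, h⟩
  have h2 : witnessSubst n r Cm (.T ℓ) = .lit ⟨ℓ, true⟩ := if_pos hℓ
  have key : ∀ l ∈ ({⟨.Tc m ℓ b, false⟩, ⟨.T ℓ, b⟩} : Clause SVar),
      substLit (witnessSubst n r Cm) l ∈
        substClause (witnessSubst n r Cm) {⟨.Tc m ℓ b, false⟩, ⟨.T ℓ, b⟩} := by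
    intro l hl
    refine Finset.mem_image_of_mem _ (Finset.mem_filter.2 ⟨hl, ?_⟩)
    simp only [Finset.mem_insert, Finset.mem_singleton] at hl
    rcases hl with rfl | rfl <;> simp [h1, h2]
  have k1 := key ⟨.Tc m ℓ b, false⟩ (by simp)
  have k2 := key ⟨.T ℓ, b⟩ (by simp)
  simp only [substLit, h1] at k1
  simp only [substLit, h2] at k2
  cases b
  · exact ⟨ℓ, k1, k2⟩
  · exact ⟨ℓ, k2, k1⟩

theorem mem_image_or_tautological {n r : ℕ} {Cm : ℕ → Clause ℕ}
    (hC : ∀ m ∈ Finset.Icc 1 r, ∀ l ∈ Cm m, l.var ∈ Finset.Icc 1 n) {E : Clause ℕ}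
    (hE : E ∈ substCnf (witnessSubst n r Cm) (restrictCnf (satCnf n r) (gammaF n r Cm))) :
    E ∈ (Finset.Icc 1 r).image Cm ∨ Tautological E := by
  obtain ⟨C, hF, hs, hτ, rfl⟩ := mem_substCnf_restrictCnf.1 hE
  rcases mem_satCnf.1 hF with ⟨m, hm, rfl⟩ | ⟨m, hm, ℓ, hℓ, b, hCb⟩
  · rw [restrictClause_eq_self gammaF_eq_none_of_mem_truthClause,
      substClause_truthClause hm (hC m hm)]
    exact .inl (Finset.mem_image_of_mem _ hm)
  · have hTc : (⟨.Tc m ℓ b, false⟩ : Lit SVar) ∈ restrictClause C (gammaF n r Cm) := by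
      rcases hCb with rfl | rfl <;> simp [restrictClause, litFalsP, gammaF]
    have h : (⟨ℓ, b⟩ : Lit ℕ) ∈ Cm m := by
      by_contra h
      exact hτ _ hTc (if_neg fun h' => h h'.2.2)
    rcases hCb with rfl | rfl
    · rw [restrictClause_eq_self (by simp [gammaF])]
      exact .inr (tautological_substClause hm hℓ h)
    · refine absurd ⟨⟨.C m ℓ b, true⟩, by simp, ?_⟩ hs
      simp only [litSatP, gammaF, if_pos (And.intro hm hℓ), h, decide_true]

theorem mem_substCnf_of_mem_Icc {n r m : ℕ} {Cm : ℕ → Clause ℕ} (hm : m ∈ Finset.Icc 1 r)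
    (hC : ∀ l ∈ Cm m, l.var ∈ Finset.Icc 1 n) :
    Cm m ∈ substCnf (witnessSubst n r Cm) (restrictCnf (satCnf n r) (gammaF n r Cm)) := by
  refine mem_substCnf_restrictCnf.2 ⟨truthClause n m, mem_satCnf.2 (.inl ⟨m, hm, rfl⟩),
    not_clauseSatP_of_forall_eq_none gammaF_eq_none_of_mem_truthClause, ?_⟩
  rw [restrictClause_eq_self gammaF_eq_none_of_mem_truthClause]
  refine ⟨fun l hl => ?_, substClause_truthClause hm hC⟩
  obtain ⟨ℓ, -, b, rfl⟩ := mem_truthClause.1 hl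
  exact witnessSubst_ne_bit_true n r Cm _

/-- For every CNF `F` with `r` clauses in `n` variables there is a
substitution `τ` of the variables of `SAT^{n,r}↾γ_F` by constants and literals of
`x_1, …, x_n` such that `(SAT^{n,r}↾γ_F)↾τ` is exactly `F` together with some
tautological clauses in the variables `x_1, …, x_n`. -/
theorem sat_substitution (n r : ℕ) (Cm : ℕ → Clause ℕ)
    (hC : ∀ m ∈ Finset.Icc 1 r, ∀ l ∈ Cm m, l.var ∈ Finset.Icc 1 n) :
    ∃ τ : SVar → SubstVal,
      (∀ v : SVar, ∀ l : Lit ℕ, τ v = .lit l → l.var ∈ Finset.Icc 1 n) ∧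
      ∃ Taut : Cnf ℕ,
        (∀ E ∈ Taut, Tautological E ∧ ∀ l ∈ E, l.var ∈ Finset.Icc 1 n) ∧
        substCnf τ (restrictCnf (satCnf n r) (gammaF n r Cm)) =
          (Finset.Icc 1 r).image Cm ∪ Taut := by
  refine ⟨witnessSubst n r Cm, fun v l h => witnessSubst_lit_var_mem h,
    (substCnf (witnessSubst n r Cm) (restrictCnf (satCnf n r) (gammaF n r Cm))).filter
      Tautological, ?_, ?_⟩
  · intro E hE
    obtain ⟨hE, hT⟩ := Finset.mem_filter.1 hE
    obtain ⟨C, -, -, -, rfl⟩ := mem_substCnf_restrictCnf.1 hE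
    exact ⟨hT, fun l hl => var_mem_of_mem_substClause hl⟩
  · ext E
    rw [Finset.mem_union, Finset.mem_filter]
    constructor
    · intro hE
      exact (mem_image_or_tautological hC hE).imp_right fun h => ⟨hE, h⟩
    · rintro (hE | hE)
      · obtain ⟨m, hm, rfl⟩ := Finset.mem_image.1 hE
        exact mem_substCnf_of_mem_Icc hm (hC m hm)
      · exact hE.1
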